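/- arXiv:1101.5336 — 2 statements merged into one kernel-verified Lean document; each statement's English description precedes it below -/
import Mathlib

section
/- Let F be a (2,3)-spread of V(7,2), let U be a 6-dimensional subspace, and suppose every 5-dimensional subspace of U has an alpha-point, i.e., a point where all five members of F contained in that subspace meet. Let W be a 4-dimensional subspace of U containing no member of F, let T be a 5-dimensional subspace of U containing W, and let P be the alpha-point of T. Then P does not belong to W. -/
abbrev V72 := Fin 7 → ZMod 2

/-- `F` is a (2,3)-spread of `V(7,2)`. -/
def IsSpread23 (F : Set (Submodule (ZMod 2) V72)) : Prop :=
  (∀ S ∈ F, Module.finrank (ZMod 2) S = 3) ∧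
  ∀ s : Submodule (ZMod 2) V72, Module.finrank (ZMod 2) s = 2 →
    ∃! S, S ∈ F ∧ s ≤ S

/-- `P` is an alpha-point of `F`: `P` is a point, and every 5-dimensional subspace
containing two members of `F` through `P` has all its members of `F` through `P`. -/
def IsAlphaPoint (F : Set (Submodule (ZMod 2) V72)) (P : Submodule (ZMod 2) V72) : Prop :=
  Module.finrank (ZMod 2) P = 1 ∧
  ∀ T : Submodule (ZMod 2) V72, Module.finrank (ZMod 2) T = 5 →
    (∃ S1 S2, S1 ∈ F ∧ S2 ∈ F ∧ S1 ≠ S2 ∧ S1 ≤ T ∧ S2 ≤ T ∧ P ≤ S1 ∧ P ≤ S2) →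
    ∀ S ∈ F, S ≤ T → P ≤ S

/-- `P` is an alpha-point of the 5-dimensional subspace `T`: a point contained in
all members of `F` lying in `T`. -/
def IsAlphaPointOf (F : Set (Submodule (ZMod 2) V72)) (T P : Submodule (ZMod 2) V72) : Prop :=
  Module.finrank (ZMod 2) P = 1 ∧ P ≤ T ∧ ∀ S ∈ F, S ≤ T → P ≤ S

open Classical Finset Module

/-- The nonzero vectors of a subspace of `V72`. -/
noncomputable def nonzeroVectors (S : Submodule (ZMod 2) V72) : Finset V72 :=
  {x | x ∈ S ∧ x ≠ 0}

lemma mem_nonzeroVectors {S : Submodule (ZMod 2) V72} {x : V72} :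
    x ∈ nonzeroVectors S ↔ x ∈ S ∧ x ≠ 0 := by
  simp [nonzeroVectors]

lemma card_nonzeroVectors (S : Submodule (ZMod 2) V72) :
    #(nonzeroVectors S) = 2 ^ finrank (ZMod 2) S - 1 := by
  have h1 : #{x : V72 | x ∈ S} = 2 ^ finrank (ZMod 2) S := by
    rw [← Fintype.card_subtype, Module.card_eq_pow_finrank (K := ZMod 2) (V := S), ZMod.card]
  have h2 : nonzeroVectors S = ({x : V72 | x ∈ S} : Finset V72).erase 0 := by
    ext x
    simp [nonzeroVectors, and_comm]
  rw [h2, card_erase_of_mem (by simp), h1]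

lemma finrank_span_pair_eq_two {x y : V72} (hx : x ≠ 0) (hy : y ≠ 0) (hxy : x ≠ y) :
    finrank (ZMod 2) (Submodule.span (ZMod 2) {x, y}) = 2 := by
  have hli : LinearIndependent (ZMod 2) ![x, y] := by
    rw [LinearIndependent.pair_iff' hx]
    intro a h
    obtain rfl | rfl : a = 0 ∨ a = 1 := by
      clear h
      decide +revert
    · exact hy (by simpa using h.symm)
    · exact hxy (by simpa using h)
  rw [← Matrix.range_cons_cons_empty x y ![], finrank_span_eq_card hli, Fintype.card_fin]

namespace IsSpread23

variable {F : Set (Submodule (ZMod 2) V72)}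

lemma existsUnique_mem (hF : IsSpread23 F) {x y : V72} (hx : x ≠ 0) (hy : y ≠ 0) (hxy : x ≠ y) :
    ∃! S, S ∈ F ∧ x ∈ S ∧ y ∈ S := by
  simpa [Submodule.span_le, Set.insert_subset_iff] using
    hF.2 _ (finrank_span_pair_eq_two hx hy hxy)

lemma card_filter_mem_mem (hF : IsSpread23 F) {x y : V72} (hx : x ≠ 0) (hy : y ≠ 0)
    (hxy : x ≠ y) : #{S | S ∈ F ∧ x ∈ S ∧ y ∈ S} = 1 := by
  rw [card_eq_one]
  obtain ⟨S, hS, huniq⟩ := hF.existsUnique_mem hx hy hxy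
  refine ⟨S, ?_⟩
  ext S'
  simp only [mem_filter, mem_univ, true_and, mem_singleton]
  exact ⟨huniq S', by rintro rfl; exact hS⟩

lemma card_filter_mem (hF : IsSpread23 F) {x : V72} (hx : x ≠ 0) :
    #{S | S ∈ F ∧ x ∈ S} = 21 := by
  have key := card_mul_eq_card_mul (s := ({S | S ∈ F ∧ x ∈ S} : Finset (Submodule (ZMod 2) V72)))
    (t := (nonzeroVectors ⊤).erase x) (fun S y => y ∈ S) (m := 6) (n := 1) ?_ ?_
  · rw [card_erase_of_mem (by simp [mem_nonzeroVectors, hx]), card_nonzeroVectors, finrank_top,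
      finrank_fin_fun] at key
    omega
  · intro S hS
    simp only [mem_filter, mem_univ, true_and] at hS
    have : bipartiteAbove (fun S y => y ∈ S) ((nonzeroVectors ⊤).erase x) S
        = (nonzeroVectors S).erase x := by
      ext y
      simp [mem_bipartiteAbove, mem_nonzeroVectors]
      tauto
    rw [this, card_erase_of_mem (mem_nonzeroVectors.2 ⟨hS.2, hx⟩), card_nonzeroVectors,
      hF.1 S hS.1]
    norm_num
  · intro y hy
    simp only [mem_erase, mem_nonzeroVectors] at hy
    refine Eq.trans (congrArg card ?_) (hF.card_filter_mem_mem hx hy.2.2 hy.1.symm)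
    ext S
    simp [mem_bipartiteBelow, and_assoc]

lemma card_eq (hF : IsSpread23 F) : #{S | S ∈ F} = 381 := by
  have key := card_mul_eq_card_mul (s := ({S | S ∈ F} : Finset (Submodule (ZMod 2) V72)))
    (t := nonzeroVectors ⊤) (fun S y => y ∈ S) (m := 7) (n := 21) ?_ ?_
  · rw [card_nonzeroVectors, finrank_top, finrank_fin_fun] at key
    omega
  · intro S hS
    simp only [mem_filter, mem_univ, true_and] at hS
    have : bipartiteAbove (fun S y => y ∈ S) (nonzeroVectors ⊤) S = nonzeroVectors S := by
      ext y
      simp [mem_bipartiteAbove, mem_nonzeroVectors, and_comm]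
    rw [this, card_nonzeroVectors, hF.1 S hS]
    norm_num
  · intro y hy
    refine Eq.trans (congrArg card ?_) (hF.card_filter_mem (mem_nonzeroVectors.1 hy).2)
    ext S
    simp [mem_bipartiteBelow]

lemma sum_card_nonzeroVectors_inf (hF : IsSpread23 F) (T : Submodule (ZMod 2) V72) :
    ∑ S with S ∈ F, #(nonzeroVectors (S ⊓ T)) = #(nonzeroVectors T) * 21 := by
  have key := sum_card_bipartiteAbove_eq_sum_card_bipartiteBelow
    (s := ({S | S ∈ F} : Finset (Submodule (ZMod 2) V72))) (t := nonzeroVectors T)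
    (fun S y => y ∈ S)
  rw [sum_const_nat (s := nonzeroVectors T) (m := 21)] at key
  · rw [← key]
    refine sum_congr rfl fun S _ => congrArg card ?_
    ext y
    simp [mem_bipartiteAbove, mem_nonzeroVectors]
    tauto
  · intro y hy
    refine Eq.trans (congrArg card ?_) (hF.card_filter_mem (mem_nonzeroVectors.1 hy).2)
    ext S
    simp [mem_bipartiteBelow]

lemma sum_card_offDiag_nonzeroVectors_inf (hF : IsSpread23 F) (T : Submodule (ZMod 2) V72) :
    ∑ S with S ∈ F, #(nonzeroVectors (S ⊓ T)).offDiag = #(nonzeroVectors T).offDiag := by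
  have key := sum_card_bipartiteAbove_eq_sum_card_bipartiteBelow
    (s := ({S | S ∈ F} : Finset (Submodule (ZMod 2) V72))) (t := (nonzeroVectors T).offDiag)
    (fun S p => p.1 ∈ S ∧ p.2 ∈ S)
  rw [sum_const_nat (s := (nonzeroVectors T).offDiag) (m := 1), mul_one] at key
  · rw [← key]
    refine sum_congr rfl fun S _ => congrArg card ?_
    ext y
    simp [mem_bipartiteAbove, mem_nonzeroVectors]
    tauto
  · intro p hp
    simp only [mem_offDiag, mem_nonzeroVectors] at hp
    refine Eq.trans (congrArg card ?_) (hF.card_filter_mem_mem hp.1.2 hp.2.1.2 hp.2.2)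
    ext S
    simp [mem_bipartiteBelow]

/-- Every 5-dimensional subspace contains exactly five members of the spread. -/
lemma card_filter_le (hF : IsSpread23 F) {T : Submodule (ZMod 2) V72}
    (hT : finrank (ZMod 2) T = 5) : #{S | S ∈ F ∧ S ≤ T} = 5 := by
  have hterm : ∀ S ∈ ({S | S ∈ F} : Finset (Submodule (ZMod 2) V72)),
      #(nonzeroVectors (S ⊓ T)).offDiag + 3
        = 3 * #(nonzeroVectors (S ⊓ T)) + 24 * (if S ≤ T then 1 else 0) := by
    intro S hS
    have hS3 : finrank (ZMod 2) S = 3 := hF.1 S (by simpa using hS)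
    have hdim := Submodule.finrank_sup_add_finrank_inf_eq S T
    have hsup : finrank (ZMod 2) ↥(S ⊔ T) ≤ 7 := by
      simpa using Submodule.finrank_le (S ⊔ T)
    have hinf : finrank (ZMod 2) ↥(S ⊓ T) ≤ 3 := hS3 ▸ Submodule.finrank_mono inf_le_left
    rw [offDiag_card, card_nonzeroVectors]
    split_ifs with h
    · rw [inf_eq_left.2 h, hS3]
      norm_num
    · have hne : finrank (ZMod 2) ↥(S ⊓ T) ≠ 3 := fun h3 =>
        h (inf_eq_left.1 (Submodule.eq_of_le_of_finrank_eq inf_le_left (h3.trans hS3.symm)))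
      obtain h1 | h2 : finrank (ZMod 2) ↥(S ⊓ T) = 1 ∨ finrank (ZMod 2) ↥(S ⊓ T) = 2 := by
        omega
      · norm_num [h1]
      · norm_num [h2]
  have hsum := sum_congr rfl hterm
  rw [sum_add_distrib, sum_add_distrib, ← mul_sum, ← mul_sum, sum_const, hF.card_eq,
    hF.sum_card_nonzeroVectors_inf, hF.sum_card_offDiag_nonzeroVectors_inf, offDiag_card,
    card_nonzeroVectors, hT, sum_boole, filter_filter] at hsum
  simp only [Nat.cast_id, smul_eq_mul] at hsum
  omega

end IsSpread23

theorem alpha_point_not_in_poor_space (F : Set (Submodule (ZMod 2) V72))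
    (hF : IsSpread23 F) (U : Submodule (ZMod 2) V72)
    (hU : Module.finrank (ZMod 2) U = 6)
    (hall : ∀ T' : Submodule (ZMod 2) V72, T' ≤ U → Module.finrank (ZMod 2) T' = 5 →
      ∃ P', IsAlphaPointOf F T' P')
    (W : Submodule (ZMod 2) V72) (hWU : W ≤ U) (hW : Module.finrank (ZMod 2) W = 4)
    (hpoor : ∀ S ∈ F, ¬ S ≤ W)
    (T : Submodule (ZMod 2) V72) (hWT : W ≤ T) (hTU : T ≤ U)
    (hT : Module.finrank (ZMod 2) T = 5)
    (P : Submodule (ZMod 2) V72) (hP : IsAlphaPointOf F T P) :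
    ¬ P ≤ W := by
  intro hPW
  have hdisj : ∀ S₁ ∈ ({S | S ∈ F ∧ S ≤ T} : Finset (Submodule (ZMod 2) V72)),
      ∀ S₂ ∈ ({S | S ∈ F ∧ S ≤ T} : Finset (Submodule (ZMod 2) V72)), S₁ ≠ S₂ →
      Disjoint (nonzeroVectors S₁ \ nonzeroVectors W) (nonzeroVectors S₂ \ nonzeroVectors W) := by
    intro S₁ h₁ S₂ h₂ hne
    simp only [mem_filter, mem_univ, true_and] at h₁ h₂
    rw [Finset.disjoint_left]
    intro x hx₁ hx₂
    simp only [mem_sdiff, mem_nonzeroVectors] at hx₁ hx₂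
    have hP0 : P ≠ ⊥ := by
      rintro rfl
      simpa using hP.1
    obtain ⟨p, hpP, hp0⟩ := P.exists_mem_ne_zero_of_ne_bot hP0
    have hxp : x ≠ p := by
      rintro rfl
      exact hx₁.2 ⟨hPW hpP, hp0⟩
    exact hne ((hF.existsUnique_mem hx₁.1.2 hp0 hxp).unique
      ⟨h₁.1, hx₁.1.1, hP.2.2 _ h₁.1 h₁.2 hpP⟩ ⟨h₂.1, hx₂.1.1, hP.2.2 _ h₂.1 h₂.2 hpP⟩)
  have hcard : ∀ S ∈ ({S | S ∈ F ∧ S ≤ T} : Finset (Submodule (ZMod 2) V72)),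
      4 ≤ #(nonzeroVectors S \ nonzeroVectors W) := by
    intro S hS
    simp only [mem_filter, mem_univ, true_and] at hS
    have hinter : nonzeroVectors W ∩ nonzeroVectors S = nonzeroVectors (S ⊓ W) := by
      ext x
      simp only [mem_inter, mem_nonzeroVectors, Submodule.mem_inf]
      tauto
    have hlt : finrank (ZMod 2) ↥(S ⊓ W) < finrank (ZMod 2) S :=
      Submodule.finrank_lt_finrank_of_lt (inf_lt_left.2 (hpoor S hS.1))
    have hS3 := hF.1 S hS.1
    have hpow : 2 ^ finrank (ZMod 2) ↥(S ⊓ W) ≤ 2 ^ 2 :=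
      Nat.pow_le_pow_right two_pos (by omega)
    rw [card_sdiff, hinter, card_nonzeroVectors, card_nonzeroVectors, hS3]
    omega
  have hsub : nonzeroVectors W ⊆ nonzeroVectors T := by
    intro x
    simp only [mem_nonzeroVectors]
    exact fun h => ⟨hWT h.1, h.2⟩
  have hunion : #(({S | S ∈ F ∧ S ≤ T} : Finset (Submodule (ZMod 2) V72)).biUnion
      fun S => nonzeroVectors S \ nonzeroVectors W) ≤ #(nonzeroVectors T \ nonzeroVectors W) := by
    refine card_le_card (biUnion_subset.2 fun S hS => sdiff_subset_sdiff ?_ le_rfl)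
    intro x
    simp only [mem_filter, mem_univ, true_and] at hS
    simp only [mem_nonzeroVectors]
    exact fun h => ⟨hS.2 h.1, h.2⟩
  rw [card_biUnion hdisj, card_sdiff_of_subset hsub, card_nonzeroVectors, card_nonzeroVectors,
    hT, hW] at hunion
  have hlow := card_nsmul_le_sum _ _ _ hcard
  rw [hF.card_filter_le hT, smul_eq_mul] at hlow
  omega
end

section
/- Let F be a (2,3)-spread of V(7,2). Then every 6-dimensional subspace U of V(7,2) contains at least one point P which is not an alpha-point of F, i.e., there exists a 5-dimensional subspace T of V(7,2) containing two members of F through P such that not all five members of F contained in T pass through P. -/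
section

open Module Submodule

open scoped Classical in
/-- The vectors of a subspace, as a finite set. -/
noncomputable def vectors (S : Submodule (ZMod 2) V72) : Finset V72 := {y | y ∈ S}

@[simp] lemma mem_vectors {S : Submodule (ZMod 2) V72} {y : V72} : y ∈ vectors S ↔ y ∈ S := by
  simp [vectors]

lemma card_vectors (S : Submodule (ZMod 2) V72) :
    (vectors S).card = 2 ^ finrank (ZMod 2) S := by
  classical
  rw [vectors, ← Fintype.card_subtype]
  simpa using Module.card_eq_pow_finrank (K := ZMod 2) (V := S)

lemma finrank_span_pair_of_ne {W : Type*} [AddCommGroup W] [Module (ZMod 2) W] {x y : W}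
    (hx : x ≠ 0) (hy : y ≠ 0) (hxy : x ≠ y) : finrank (ZMod 2) (span (ZMod 2) {x, y}) = 2 := by
  have h : LinearIndependent (ZMod 2) ![x, y] := by
    rw [LinearIndependent.pair_iff' hx]
    intro a
    obtain rfl | rfl : a = 0 ∨ a = 1 := by revert a; decide
    · simpa using hy.symm
    · simpa using hxy
  rw [← Matrix.range_cons_cons_empty x y ![]]
  simpa using finrank_span_eq_card h

lemma IsSpread23.existsUnique_mem_mem {F : Set (Submodule (ZMod 2) V72)} (hF : IsSpread23 F)
    {x y : V72} (hx : x ≠ 0) (hy : y ≠ 0) (hxy : x ≠ y) : ∃! S, S ∈ F ∧ x ∈ S ∧ y ∈ S := by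
  simpa [span_le, Set.insert_subset_iff] using hF.2 _ (finrank_span_pair_of_ne hx hy hxy)

/-- The members of `F`, as a finite set. -/
noncomputable def members (F : Set (Submodule (ZMod 2) V72)) :
    Finset (Submodule (ZMod 2) V72) := (Set.toFinite F).toFinset

@[simp] lemma mem_members {F : Set (Submodule (ZMod 2) V72)} {S : Submodule (ZMod 2) V72} :
    S ∈ members F ↔ S ∈ F := by
  simp [members]

open scoped Classical in
/-- Double counting: every pair of independent vectors lies in exactly one member of `F`. -/
lemma IsSpread23.card_eq_sum {F : Set (Submodule (ZMod 2) V72)} (hF : IsSpread23 F)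
    (D : Finset (V72 × V72)) (hD : ∀ p ∈ D, p.1 ≠ 0 ∧ p.2 ≠ 0 ∧ p.1 ≠ p.2) :
    D.card = ∑ S ∈ members F, (D.filter fun p => p.1 ∈ S ∧ p.2 ∈ S).card := by
  have h : ∀ p : V72 × V72, ∃ S, p ∈ D → S ∈ F ∧ p.1 ∈ S ∧ p.2 ∈ S ∧
      ∀ S', S' ∈ F ∧ p.1 ∈ S' ∧ p.2 ∈ S' → S' = S := by
    intro p
    by_cases hp : p ∈ D
    · obtain ⟨h1, h2, h3⟩ := hD p hp
      obtain ⟨S, ⟨a, b, c⟩, d⟩ := hF.existsUnique_mem_mem h1 h2 h3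
      exact ⟨S, fun _ => ⟨a, b, c, d⟩⟩
    · exact ⟨⊥, fun h => absurd h hp⟩
  choose f hf using h
  rw [Finset.card_eq_sum_card_fiberwise (f := f) (t := members F)
    (fun p hp => mem_members.2 (hf p hp).1)]
  refine Finset.sum_congr rfl fun S hS => congrArg Finset.card (Finset.filter_congr ?_)
  intro p hp
  obtain ⟨_, h2, h3, h4⟩ := hf p hp
  constructor
  · rintro rfl
    exact ⟨h2, h3⟩
  · exact fun h => (h4 S ⟨mem_members.1 hS, h⟩).symm

lemma card_vectors_erase {S : Submodule (ZMod 2) V72} :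
    ((vectors S).erase 0).card = 2 ^ finrank (ZMod 2) S - 1 := by
  rw [Finset.card_erase_of_mem (by simp), card_vectors]

lemma card_vectors_sdiff (S T : Submodule (ZMod 2) V72) :
    (vectors S \ vectors T).card =
      2 ^ finrank (ZMod 2) S - 2 ^ finrank (ZMod 2) (S ⊓ T : Submodule (ZMod 2) V72) := by
  rw [← card_vectors, ← card_vectors, ← Finset.card_sdiff_of_subset]
  · congr 1
    ext y
    simp +contextual
  · intro y
    simp +contextual

open scoped Classical in
/-- Every 5-dimensional subspace contains exactly five members of `F`. -/
lemma IsSpread23.card_filter_le_s14 {F : Set (Submodule (ZMod 2) V72)}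
    (hF : IsSpread23 F) {T : Submodule (ZMod 2) V72} (hT : finrank (ZMod 2) T = 5) :
    ((members F).filter (· ≤ T)).card = 5 := by
  have h1 := hF.card_eq_sum ((vectors T).erase 0).offDiag (by simp +contextual)
  have h2 := hF.card_eq_sum ((vectors T).erase 0 ×ˢ (vectors ⊤ \ vectors T)) (by
    rintro ⟨x, y⟩ h
    simp only [Finset.mem_product, Finset.mem_erase, mem_vectors, Finset.mem_sdiff] at h
    refine ⟨h.1.1, ?_, ?_⟩
    · rintro rfl
      exact h.2.2 T.zero_mem
    · rintro (rfl : x = y)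
      exact h.2.2 h.1.2)
  have h3 := hF.card_eq_sum (vectors ⊤ \ vectors T).offDiag (by
    rintro ⟨x, y⟩ h
    simp only [Finset.mem_offDiag, mem_vectors, Finset.mem_sdiff] at h
    refine ⟨?_, ?_, h.2.2⟩
    · rintro rfl
      exact h.1.2 T.zero_mem
    · rintro rfl
      exact h.2.1.2 T.zero_mem)
  have e1 (S : Submodule (ZMod 2) V72) : (((vectors T).erase 0).offDiag.filter
      fun p => p.1 ∈ S ∧ p.2 ∈ S) = ((vectors (S ⊓ T)).erase 0).offDiag := by
    ext; simp; tauto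
  have e2 (S : Submodule (ZMod 2) V72) : (((vectors T).erase 0 ×ˢ (vectors ⊤ \ vectors T)).filter
      fun p => p.1 ∈ S ∧ p.2 ∈ S) = (vectors (S ⊓ T)).erase 0 ×ˢ (vectors S \ vectors T) := by
    ext; simp; tauto
  have e3 (S : Submodule (ZMod 2) V72) : ((vectors ⊤ \ vectors T).offDiag.filter
      fun p => p.1 ∈ S ∧ p.2 ∈ S) = (vectors S \ vectors T).offDiag := by
    ext; simp; tauto
  have hT' : finrank (ZMod 2) (⊤ ⊓ T : Submodule (ZMod 2) V72) = 5 := by rw [top_inf_eq, hT]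
  simp only [e1, e2, e3, Finset.offDiag_card, Finset.card_product, card_vectors_erase,
    card_vectors_sdiff, hT, hT', finrank_top, finrank_fin_fun] at h1 h2 h3
  have key : ∀ S ∈ members F,
      let s := finrank (ZMod 2) (S ⊓ T : Submodule (ZMod 2) V72)
      let r := finrank (ZMod 2) S
      8 * ((2 ^ s - 1) * (2 ^ s - 1) - (2 ^ s - 1)) +
        ((2 ^ r - 2 ^ s) * (2 ^ r - 2 ^ s) - (2 ^ r - 2 ^ s)) =
      5 * ((2 ^ s - 1) * (2 ^ r - 2 ^ s)) + if S ≤ T then 336 else 0 := by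
    intro S hS s r
    have hr : r = 3 := hF.1 S (mem_members.1 hS)
    have hle : s ≤ 3 := hr ▸ Submodule.finrank_mono inf_le_left
    have hge : 1 ≤ s := by
      have := Submodule.finrank_sup_add_finrank_inf_eq S T
      have h' := (S ⊔ T).finrank_le
      rw [finrank_fin_fun] at h'
      omega
    have hs : S ≤ T ↔ s = 3 := by
      constructor
      · intro h
        rw [← hr]
        simp only [s, r]
        rw [inf_eq_left.2 h]
      · intro h
        exact inf_eq_left.1 (Submodule.eq_of_le_of_finrank_eq inf_le_left (h.trans hr.symm))
    rw [hr]
    simp only [hs]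
    interval_cases s <;> simp
  have := Finset.sum_congr rfl key
  simp only [Finset.sum_add_distrib, ← Finset.mul_sum, ← h1, ← h2, ← h3, Finset.sum_ite,
    Finset.sum_const] at this
  norm_num at this
  omega

open scoped Classical in
/-- Every point of a hyperplane `U` is on exactly five members of `F` inside `U`. -/
lemma IsSpread23.card_filter_le_and_mem {F : Set (Submodule (ZMod 2) V72)}
    (hF : IsSpread23 F) {U : Submodule (ZMod 2) V72} (hU : finrank (ZMod 2) U = 6) {x : V72}
    (hx : x ≠ 0) (hxU : x ∈ U) :
    ((members F).filter fun S => S ≤ U ∧ x ∈ S).card = 5 := by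
  have h1 := hF.card_eq_sum ({x} ×ˢ (((vectors ⊤).erase 0).erase x))
    (by simp +contextual [hx, eq_comm])
  have h2 := hF.card_eq_sum ({x} ×ˢ (vectors ⊤ \ vectors U)) (by
    rintro ⟨a, y⟩ h
    simp only [Finset.mem_product, Finset.mem_singleton, mem_vectors, Finset.mem_sdiff] at h
    obtain ⟨rfl, -, h⟩ := h
    refine ⟨hx, ?_, ?_⟩
    · rintro rfl
      exact h U.zero_mem
    · rintro (rfl : a = y)
      exact h hxU)
  have e1 (S : Submodule (ZMod 2) V72) : (({x} ×ˢ (((vectors ⊤).erase 0).erase x)).filter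
      fun p => p.1 ∈ S ∧ p.2 ∈ S) =
      if x ∈ S then {x} ×ˢ (((vectors S).erase 0).erase x) else ∅ := by
    ext ⟨a, b⟩; split_ifs with h <;> simp <;> aesop
  have e2 (S : Submodule (ZMod 2) V72) : (({x} ×ˢ (vectors ⊤ \ vectors U)).filter
      fun p => p.1 ∈ S ∧ p.2 ∈ S) =
      if x ∈ S then {x} ×ˢ (vectors S \ vectors U) else ∅ := by
    ext ⟨a, b⟩; split_ifs with h <;> simp <;> aesop
  have hU' : finrank (ZMod 2) (⊤ ⊓ U : Submodule (ZMod 2) V72) = 6 := by rw [top_inf_eq, hU]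
  simp only [e1, e2, apply_ite Finset.card, Finset.card_product, Finset.card_singleton, one_mul,
    card_vectors_sdiff, Finset.card_empty, hU', finrank_top, finrank_fin_fun] at h1 h2
  rw [Finset.card_erase_of_mem (by simp [hx]), card_vectors_erase, finrank_top,
    finrank_fin_fun] at h1
  have key1 : ∀ S ∈ members F,
      (if x ∈ S then (((vectors S).erase 0).erase x).card else 0) = if x ∈ S then 6 else 0 := by
    intro S hS
    split_ifs with h
    · rw [Finset.card_erase_of_mem (by simp [hx, h]), card_vectors_erase,
        hF.1 S (mem_members.1 hS)]
      rfl
    · rfl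
  have key2 : ∀ S ∈ members F,
      (if x ∈ S then 2 ^ finrank (ZMod 2) S - 2 ^ finrank (ZMod 2) (S ⊓ U : Submodule _ _) else 0) +
        (if S ≤ U ∧ x ∈ S then 4 else 0) = if x ∈ S then 4 else 0 := by
    intro S hS
    have hr := hF.1 S (mem_members.1 hS)
    split_ifs with h h' h' <;> try tauto
    · rw [inf_eq_left.2 h'.1]
      simp
    · have hS' : finrank (ZMod 2) (S ⊓ U : Submodule _ _) = 2 := by
        have h1 := Submodule.finrank_sup_add_finrank_inf_eq S U
        have h2 := (S ⊔ U).finrank_le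
        have h3 : finrank (ZMod 2) (S ⊓ U : Submodule _ _) < finrank (ZMod 2) S :=
          Submodule.finrank_lt_finrank_of_lt (inf_lt_left.2 fun h'' => h' ⟨h'', h⟩)
        rw [finrank_fin_fun] at h2
        omega
      rw [hr, hS']
      rfl
  rw [Finset.sum_congr rfl key1] at h1
  have := Finset.sum_congr rfl key2
  rw [Finset.sum_add_distrib, ← h2] at this
  simp only [Finset.sum_ite, Finset.sum_const] at this h1
  norm_num at this h1
  omega

lemma ZMod.eq_zero_or_one_of_two (a : ZMod 2) : a = 0 ∨ a = 1 := by
  revert a; decide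

/-- A spread of blocks in a 6-dimensional symplectic space over `ZMod 2`: totally isotropic
3-dimensional subspaces such that every totally isotropic line lies in exactly one of them
(an ovoid of the dual polar space). -/
structure IsIsotropicSpread {W : Type*} [AddCommGroup W] [Module (ZMod 2) W]
    (ω : W → W →ₗ[ZMod 2] ZMod 2) (L : Set (Submodule (ZMod 2) W)) : Prop where
  symm : ∀ x y, ω x y = ω y x
  nondegenerate : ∀ x, ω x = 0 → x = 0
  finrank_eq : ∀ S ∈ L, finrank (ZMod 2) S = 3
  isotropic : ∀ S ∈ L, ∀ x ∈ S, ∀ y ∈ S, ω x y = 0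
  exists_mem : ∀ x y, ω x y = 0 → ∃ S ∈ L, x ∈ S ∧ y ∈ S
  unique : ∀ S ∈ L, ∀ S' ∈ L, ∀ x y, x ≠ 0 → y ≠ 0 → x ≠ y → x ∈ S → y ∈ S → x ∈ S' → y ∈ S' →
    S = S'

namespace IsIsotropicSpread

variable {W : Type*} [AddCommGroup W] [Module (ZMod 2) W]
  {ω : W → W →ₗ[ZMod 2] ZMod 2} {L : Set (Submodule (ZMod 2) W)}

lemma add_left (h : IsIsotropicSpread ω L) (x y z : W) : ω (x + y) z = ω x z + ω y z := by
  rw [h.symm, map_add, h.symm z x, h.symm z y]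

lemma self_eq_zero (h : IsIsotropicSpread ω L) (x : W) : ω x x = 0 := by
  obtain ⟨S, hS, hx, -⟩ := h.exists_mem x 0 (map_zero _)
  exact h.isotropic S hS x hx x hx

/-- The planes spanned by the line `⟨x, y⟩` and by `p`, `q` and `p + q` respectively are the three
totally isotropic planes on that line, and one of them is a block. -/
lemma exists_mem_of_line [FiniteDimensional (ZMod 2) W] (h : IsIsotropicSpread ω L)
    (hW : finrank (ZMod 2) W = 6) {x y p q : W} (hx : x ≠ 0) (hy : y ≠ 0) (hne : x ≠ y)
    (hxy : ω x y = 0) (hxp : ω x p = 0) (hxq : ω x q = 0) (hyp : ω y p = 0) (hyq : ω y q = 0)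
    (hpq : ω p q = 1) :
    ∃ S ∈ L, x ∈ S ∧ y ∈ S ∧ (p ∈ S ∨ q ∈ S ∨ p + q ∈ S) := by
  obtain ⟨S, hS, hxS, hyS⟩ := h.exists_mem x y hxy
  refine ⟨S, hS, hxS, hyS, ?_⟩
  have hker : ∀ z, z ≠ 0 → finrank (ZMod 2) (LinearMap.ker (ω z)) = 5 := by
    intro z hz
    have h1 := Module.Dual.finrank_ker_add_one_of_ne_zero (f := ω z) (mt (h.nondegenerate z) hz)
    omega
  have hK : finrank (ZMod 2) (LinearMap.ker (ω x) ⊓ LinearMap.ker (ω y) : Submodule _ _) ≤ 4 := by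
    by_contra! hK
    have h1 : LinearMap.ker (ω x) ⊓ LinearMap.ker (ω y) = LinearMap.ker (ω x) :=
      Submodule.eq_of_le_of_finrank_le inf_le_left (by rw [hker x hx]; omega)
    have h2 : LinearMap.ker (ω x) ⊓ LinearMap.ker (ω y) = LinearMap.ker (ω y) :=
      Submodule.eq_of_le_of_finrank_le inf_le_right (by rw [hker y hy]; omega)
    have h3 : ∀ z, ω x z = 0 ↔ ω y z = 0 := fun z => by
      rw [← LinearMap.mem_ker, ← h1, h2, LinearMap.mem_ker]
    have h4 : ω (x + y) = 0 := by
      ext z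
      rw [h.add_left, LinearMap.zero_apply]
      have := h3 z
      generalize ω x z = a at *
      generalize ω y z = b at *
      revert a b
      decide
    have h5 := h.nondegenerate _ h4
    have h6 : y + y = 0 := ZModModule.add_self y
    exact hne (add_right_cancel (h5.trans h6.symm))
  have hSK : S ≤ LinearMap.ker (ω x) ⊓ LinearMap.ker (ω y) := fun z hz =>
    ⟨h.isotropic S hS x hxS z hz, h.isotropic S hS y hyS z hz⟩
  have hpqK : span (ZMod 2) {p, q} ≤ LinearMap.ker (ω x) ⊓ LinearMap.ker (ω y) := by
    simp [span_le, Set.insert_subset_iff, hxp, hxq, hyp, hyq]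
  have hp : p ≠ 0 := by
    rintro rfl
    simp [h.symm] at hpq
  have hq : q ≠ 0 := by
    rintro rfl
    simp at hpq
  have hpq' : p ≠ q := by
    rintro rfl
    simp [h.self_eq_zero] at hpq
  have hspan := finrank_span_pair_of_ne hp hq hpq'
  have hsum := Submodule.finrank_sup_add_finrank_inf_eq S (span (ZMod 2) {p, q})
  have hsup := (Submodule.finrank_mono (sup_le hSK hpqK)).trans hK
  rw [h.finrank_eq S hS, hspan] at hsum
  have hinf : S ⊓ span (ZMod 2) {p, q} ≠ ⊥ := by
    intro hbot
    rw [hbot, finrank_bot] at hsum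
    omega
  obtain ⟨z, ⟨hzS, hz⟩, hz0⟩ := Submodule.exists_mem_ne_zero_of_ne_bot hinf
  obtain ⟨a, b, rfl⟩ := Submodule.mem_span_pair.1 hz
  obtain rfl | rfl := ZMod.eq_zero_or_one_of_two a <;>
  obtain rfl | rfl := ZMod.eq_zero_or_one_of_two b <;> simp_all

/-- There are no two blocks spanned by dual bases. -/
lemma false_of_dual [FiniteDimensional (ZMod 2) W] (h : IsIsotropicSpread ω L)
    (hW : finrank (ZMod 2) W = 6) {A B : Submodule (ZMod 2) W} (hA : A ∈ L) (hB : B ∈ L)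
    {e₁ e₂ e₃ f₁ f₂ f₃ : W} (he₁ : e₁ ∈ B) (he₂ : e₂ ∈ B) (he₃ : e₃ ∈ B)
    (hf₁ : f₁ ∈ A) (hf₂ : f₂ ∈ A) (hf₃ : f₃ ∈ A)
    (h₁₁ : ω e₁ f₁ = 1) (h₁₂ : ω e₁ f₂ = 0) (h₁₃ : ω e₁ f₃ = 0)
    (h₂₁ : ω e₂ f₁ = 0) (h₂₂ : ω e₂ f₂ = 1) (h₂₃ : ω e₂ f₃ = 0)
    (h₃₁ : ω e₃ f₁ = 0) (h₃₂ : ω e₃ f₂ = 0) (h₃₃ : ω e₃ f₃ = 1) : False := by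
  have g₁₁ := (h.symm _ _).trans h₁₁
  have g₁₂ := (h.symm _ _).trans h₁₂
  have g₁₃ := (h.symm _ _).trans h₁₃
  have g₂₁ := (h.symm _ _).trans h₂₁
  have g₂₂ := (h.symm _ _).trans h₂₂
  have g₂₃ := (h.symm _ _).trans h₂₃
  have g₃₁ := (h.symm _ _).trans h₃₁
  have g₃₂ := (h.symm _ _).trans h₃₂
  have g₃₃ := (h.symm _ _).trans h₃₃
  have e₁₂ := h.isotropic B hB _ he₁ _ he₂
  have e₁₃ := h.isotropic B hB _ he₁ _ he₃
  have e₂₃ := h.isotropic B hB _ he₂ _ he₃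
  have e₂₁ := h.isotropic B hB _ he₂ _ he₁
  have e₃₁ := h.isotropic B hB _ he₃ _ he₁
  have e₃₂ := h.isotropic B hB _ he₃ _ he₂
  have f₁₂ := h.isotropic A hA _ hf₁ _ hf₂
  have f₁₃ := h.isotropic A hA _ hf₁ _ hf₃
  have f₂₃ := h.isotropic A hA _ hf₂ _ hf₃
  have f₂₁ := h.isotropic A hA _ hf₂ _ hf₁
  have f₃₁ := h.isotropic A hA _ hf₃ _ hf₁
  have f₃₂ := h.isotropic A hA _ hf₃ _ hf₂
  have self := h.self_eq_zero
  have add := h.add_left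
  have two : (1 + 1 : ZMod 2) = 0 := by decide
  -- Vectors are told apart, and distinguished from zero, by a value of the form.
  have ne : ∀ z x y, ω z x = 1 → ω z y = 0 → x ≠ y := by
    rintro z x y hx hy rfl
    simp [hx] at hy
  have nz : ∀ z x, ω z x = 1 → x ≠ 0 := by
    rintro z x hx rfl
    simp at hx
  -- Two blocks on a common line are equal, hence all their vectors are orthogonal.
  have clash : ∀ S ∈ L, ∀ S' ∈ L, ∀ a b x y p q : W, ω a x = 1 → ω b y = 1 → ω b x = 0 →
      x ∈ S → y ∈ S → x ∈ S' → y ∈ S' → p ∈ S → q ∈ S' → ω p q = 1 → False := by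
    intro S hS S' hS' a b x y p q hax hby hbx hx hy hx' hy' hp hq hpq
    obtain rfl := h.unique S hS S' hS' x y (nz a x hax) (nz b y hby) (ne b y x hby hbx).symm
      hx hy hx' hy'
    rw [h.isotropic S hS p hp q hq] at hpq
    exact zero_ne_one hpq
  have line : ∀ a b x y p q : W, ω a x = 1 → ω b y = 1 → ω b x = 0 → ω x y = 0 → ω x p = 0 →
      ω x q = 0 → ω y p = 0 → ω y q = 0 → ω p q = 1 →
      ∃ S ∈ L, x ∈ S ∧ y ∈ S ∧ (p ∈ S ∨ q ∈ S ∨ p + q ∈ S) := by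
    intro a b x y p q hax hby hbx
    exact h.exists_mem_of_line hW (nz a x hax) (nz b y hby) (ne b y x hby hbx).symm
  obtain ⟨S₁, hS₁, m₁, m₂, m₃⟩ : ∃ S ∈ L, e₃ ∈ S ∧ f₁ ∈ S ∧ e₂ + f₂ ∈ S := by
    obtain ⟨S, hS, h1, h2, h3 | h3 | h3⟩ := line f₃ e₁ e₃ f₁ e₂ f₂ (by simp [*]) (by simp [*])
      (by simp [*]) (by simp [*]) (by simp [*]) (by simp [*]) (by simp [*]) (by simp [*])
      (by simp [*])
    · exact (clash S hS B hB f₃ f₂ e₃ e₂ f₁ e₁ (by simp [*]) (by simp [*]) (by simp [*])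
        h1 h3 he₃ he₂ h2 he₁ (by simp [*])).elim
    · exact (clash S hS A hA e₁ e₂ f₁ f₂ e₃ f₃ (by simp [*]) (by simp [*]) (by simp [*])
        h2 h3 hf₁ hf₂ h1 hf₃ (by simp [*])).elim
    · exact ⟨S, hS, h1, h2, h3⟩
  obtain ⟨S₂, hS₂, n₁, n₂, n₃⟩ : ∃ S ∈ L, e₁ ∈ S ∧ f₃ ∈ S ∧ e₂ + f₂ ∈ S := by
    obtain ⟨S, hS, h1, h2, h3 | h3 | h3⟩ := line f₁ e₃ e₁ f₃ e₂ f₂ (by simp [*]) (by simp [*])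
      (by simp [*]) (by simp [*]) (by simp [*]) (by simp [*]) (by simp [*]) (by simp [*])
      (by simp [*])
    · exact (clash S hS B hB f₁ f₂ e₁ e₂ f₃ e₃ (by simp [*]) (by simp [*]) (by simp [*])
        h1 h3 he₁ he₂ h2 he₃ (by simp [*])).elim
    · exact (clash S hS A hA e₃ e₂ f₃ f₂ e₁ f₁ (by simp [*]) (by simp [*]) (by simp [*])
        h2 h3 hf₃ hf₂ h1 hf₁ (by simp [*])).elim
    · exact ⟨S, hS, h1, h2, h3⟩
  have add_cancel : ∀ x y : W, x + (x + y) = y := fun x y => by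
    rw [← add_assoc, ZModModule.add_self, zero_add]
  have eq₁ : (e₁ + e₂) + (e₁ + f₁) = e₂ + f₁ := by
    rw [add_comm e₁ e₂, add_assoc, add_cancel]
  obtain ⟨S₃, hS₃, k₁, k₂, k₃⟩ :
      ∃ S ∈ L, e₃ ∈ S ∧ (e₁ + f₁) + (e₂ + f₂) ∈ S ∧ e₂ + f₁ ∈ S := by
    obtain ⟨S, hS, h1, h2, h3 | h3 | h3⟩ := line f₃ e₁ e₃ ((e₁ + f₁) + (e₂ + f₂)) (e₁ + e₂)
      (e₁ + f₁) (by simp [*]) (by simp [*])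
      (by simp [*]) (by simp [*]) (by simp [*]) (by simp [*]) (by simp [*]) (by simp [*])
      (by simp [*])
    · exact (clash S hS B hB f₃ f₁ e₃ (e₁ + e₂) ((e₁ + f₁) + (e₂ + f₂)) e₁
        (by simp [*]) (by simp [*]) (by simp [*])
        h1 h3 he₃ (B.add_mem he₁ he₂) h2 he₁ (by simp [*])).elim
    · have h4 : e₂ + f₂ ∈ S := (S.add_mem_iff_right h3).1 h2
      exact (clash S hS S₁ hS₁ f₃ e₂ e₃ (e₂ + f₂) (e₁ + f₁) f₁
        (by simp [*]) (by simp [*]) (by simp [*])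
        h1 h4 m₁ m₃ h3 m₂ (by simp [*])).elim
    · exact ⟨S, hS, h1, h2, eq₁ ▸ h3⟩
  obtain ⟨S₄, hS₄, l₁, l₂, l₃⟩ :
      ∃ S ∈ L, f₃ ∈ S ∧ (e₁ + f₁) + (e₂ + f₂) ∈ S ∧ e₂ + f₁ ∈ S := by
    obtain ⟨S, hS, h1, h2, h3 | h3 | h3⟩ := line e₃ e₁ f₃ ((e₁ + f₁) + (e₂ + f₂)) (e₁ + e₂)
      (e₁ + f₁) (by simp [*]) (by simp [*])
      (by simp [*]) (by simp [*]) (by simp [*]) (by simp [*]) (by simp [*]) (by simp [*])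
      (by simp [*])
    · have h4 : f₁ + f₂ ∈ S := by
        rw [add_add_add_comm] at h2
        exact (S.add_mem_iff_right h3).1 h2
      exact (clash S hS A hA e₃ e₁ f₃ (f₁ + f₂) (e₁ + e₂) f₁
        (by simp [*]) (by simp [*]) (by simp [*])
        h1 h4 hf₃ (A.add_mem hf₁ hf₂) h3 hf₁ (by simp [*])).elim
    · have h4 : e₂ + f₂ ∈ S := (S.add_mem_iff_right h3).1 h2
      exact (clash S hS S₂ hS₂ e₃ e₂ f₃ (e₂ + f₂) (e₁ + f₁) e₁
        (by simp [*]) (by simp [*]) (by simp [*])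
        h1 h4 n₂ n₃ h3 n₁ (by simp [*])).elim
    · exact ⟨S, hS, h1, h2, eq₁ ▸ h3⟩
  exact clash S₃ hS₃ S₄ hS₄ e₁ f₁ (e₂ + f₁) ((e₁ + f₁) + (e₂ + f₂)) e₃ f₃
    (by simp [*]) (by simp [*]) (by simp [*]) k₃ k₂ l₃ l₂ k₁ l₁ h₃₃

/-- There are two blocks meeting only in zero. -/
lemma exists_disjoint [FiniteDimensional (ZMod 2) W] (h : IsIsotropicSpread ω L)
    (hW : finrank (ZMod 2) W = 6) : ∃ A ∈ L, ∃ B ∈ L, Disjoint A B := by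
  obtain ⟨B, hB, -, -⟩ := h.exists_mem 0 0 (map_zero _)
  have hB3 := h.finrank_eq B hB
  obtain ⟨z, hzB, hz0⟩ : ∃ z ∈ B, z ≠ 0 := by
    refine Submodule.exists_mem_ne_zero_of_ne_bot fun hbot => ?_
    rw [hbot, finrank_bot] at hB3
    omega
  obtain ⟨f, hzf⟩ : ∃ f, ω z f ≠ 0 := by
    by_contra! hz
    exact hz0 (h.nondegenerate z (LinearMap.ext hz))
  have hf : f ∉ B := fun hfB => hzf (h.isotropic B hB z hzB f hfB)
  have hf0 : f ≠ 0 := fun h0 => hf (h0 ▸ B.zero_mem)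
  have hrank : finrank (ZMod 2) (B ⊓ LinearMap.ker (ω f) : Submodule _ _) = 2 := by
    have h1 := Submodule.finrank_sup_add_finrank_inf_eq B (LinearMap.ker (ω f))
    have h2 := (B ⊔ LinearMap.ker (ω f)).finrank_le
    have h3 := Module.Dual.finrank_ker_add_one_of_ne_zero (f := ω f) (mt (h.nondegenerate f) hf0)
    have h4 : finrank (ZMod 2) (B ⊓ LinearMap.ker (ω f) : Submodule _ _) < finrank (ZMod 2) B :=
      Submodule.finrank_lt_finrank_of_lt
        (inf_lt_left.2 fun hle => hzf ((h.symm z f).trans (hle hzB)))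
    omega
  obtain ⟨x, ⟨hxB, hfx⟩, hx0⟩ : ∃ x ∈ B ⊓ LinearMap.ker (ω f), x ≠ 0 := by
    refine Submodule.exists_mem_ne_zero_of_ne_bot fun hbot => ?_
    rw [hbot, finrank_bot] at hrank
    omega
  obtain ⟨y, ⟨hyB, hfy⟩, hyx⟩ : ∃ y ∈ B ⊓ LinearMap.ker (ω f), y ∉ span (ZMod 2) {x} := by
    by_contra! hle
    have := Submodule.finrank_mono (show B ⊓ LinearMap.ker (ω f) ≤ span (ZMod 2) {x} from hle)
    rw [finrank_span_singleton hx0] at this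
    omega
  have hy0 : y ≠ 0 := fun h0 => hyx (h0 ▸ Submodule.zero_mem _)
  have hxy : x ≠ y := fun h0 => hyx (h0 ▸ mem_span_singleton_self _)
  have hspan : span (ZMod 2) {x, y} = B ⊓ LinearMap.ker (ω f) := by
    refine Submodule.eq_of_le_of_finrank_eq ?_
      ((finrank_span_pair_of_ne hx0 hy0 hxy).trans hrank.symm)
    exact span_le.2 (Set.insert_subset ⟨hxB, hfx⟩ (Set.singleton_subset_iff.2 ⟨hyB, hfy⟩))
  obtain ⟨Y, hY, hfY, hyY⟩ := h.exists_mem f y hfy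
  have hxY : x ∉ Y := fun hxY =>
    hf (h.unique Y hY B hB x y hx0 hy0 hxy hxY hyY hxB hyB ▸ hfY)
  have hfy' : f ≠ y := fun h0 => hf (h0 ▸ hyB)
  obtain ⟨g, hgY, hg⟩ : ∃ g ∈ Y, g ∉ span (ZMod 2) {f, y} := by
    by_contra! hle
    have h1 := Submodule.finrank_mono (show Y ≤ span (ZMod 2) {f, y} from hle)
    rw [finrank_span_pair_of_ne hf0 hy0 hfy', h.finrank_eq Y hY] at h1
    omega
  have hfs : f ∈ span (ZMod 2) {f, y} := subset_span (by simp)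
  have hys : y ∈ span (ZMod 2) {f, y} := subset_span (by simp)
  obtain ⟨A, hA, hfA, hxgA⟩ := h.exists_mem f (x + g) (by
    rw [map_add, LinearMap.mem_ker.1 hfx, h.isotropic Y hY f hfY g hgY, add_zero])
  have hAY : ∀ u, u ∈ Y → u ∈ A → u ≠ 0 → f ≠ u → False := by
    intro u huY huA hu hfu
    obtain rfl := h.unique A hA Y hY f u hf0 hu hfu hfA huA hfY huY
    exact hxY ((A.add_mem_iff_left hgY).1 hxgA)
  refine ⟨A, hA, B, hB, Submodule.disjoint_def.2 fun p hpA hpB => ?_⟩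
  have hp : p ∈ span (ZMod 2) {x, y} := hspan ▸ ⟨hpB, h.isotropic A hA f hfA p hpA⟩
  obtain ⟨a, b, rfl⟩ := Submodule.mem_span_pair.1 hp
  obtain rfl | rfl := ZMod.eq_zero_or_one_of_two a <;>
  obtain rfl | rfl := ZMod.eq_zero_or_one_of_two b <;>
  simp only [zero_smul, one_smul, zero_add, add_zero] at hpA ⊢ <;> exfalso
  · exact hAY y hyY hpA hy0 hfy'
  · have hgA : g ∈ A := (A.add_mem_iff_right hpA).1 hxgA
    exact hAY g hgY hgA (fun h0 => hg (h0 ▸ Submodule.zero_mem _)) (fun h0 => hg (h0 ▸ hfs))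
  · have hygA : y + g ∈ A := by
      have h1 := A.add_mem hpA hxgA
      rwa [add_add_add_comm, ZModModule.add_self, zero_add] at h1
    refine hAY (y + g) (Y.add_mem hyY hgY) hygA (fun h0 => hg ?_) (fun h0 => hg ?_)
    · exact ((span (ZMod 2) {f, y}).add_mem_iff_right hys).1 (h0 ▸ Submodule.zero_mem _)
    · exact ((span (ZMod 2) {f, y}).add_mem_iff_right hys).1 (h0 ▸ hfs)

/-- Isotropic spreads do not exist in dimension six. -/
theorem finrank_ne_six [FiniteDimensional (ZMod 2) W] (h : IsIsotropicSpread ω L) :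
    finrank (ZMod 2) W ≠ 6 := by
  intro hW
  obtain ⟨A, hA, B, hB, hAB⟩ := h.exists_disjoint hW
  have hA3 := h.finrank_eq A hA
  have hB3 := h.finrank_eq B hB
  have htop : A ⊔ B = ⊤ := by
    have h1 := Submodule.finrank_sup_add_finrank_inf_eq A B
    rw [hAB.eq_bot, finrank_bot] at h1
    exact Submodule.eq_top_of_finrank_eq (by omega)
  let φ : B →ₗ[ZMod 2] Dual (ZMod 2) A :=
    { toFun := fun b => (ω b).comp A.subtype
      map_add' := fun b c => by
        ext a
        simp [h.add_left]
      map_smul' := fun r b => by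
        ext a
        obtain rfl | rfl := ZMod.eq_zero_or_one_of_two r
        · simp [h.symm 0]
        · simp }
  have hinj : Function.Injective φ := by
    rw [← LinearMap.ker_eq_bot, Submodule.eq_bot_iff]
    intro b hb
    have hle : A ⊔ B ≤ LinearMap.ker (ω b) := sup_le
      (fun a ha => LinearMap.congr_fun (LinearMap.mem_ker.1 hb) ⟨a, ha⟩)
      (fun c hc => h.isotropic B hB b b.2 c hc)
    rw [htop, top_le_iff, LinearMap.ker_eq_top] at hle
    exact Subtype.ext (h.nondegenerate _ hle)
  have hsurj : Function.Surjective φ :=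
    (LinearMap.injective_iff_surjective_of_finrank_eq_finrank
      (by rw [Subspace.dual_finrank_eq, hA3, hB3])).1 hinj
  let f := finBasisOfFinrankEq (ZMod 2) A hA3
  choose e he using fun i => hsurj (f.coord i)
  have hef : ∀ i j, ω (e i) (f j) = if j = i then 1 else 0 := fun i j => by
    have h1 := LinearMap.congr_fun (he i) (f j)
    rw [Basis.coord_apply, Basis.repr_self, Finsupp.single_apply] at h1
    exact h1
  refine h.false_of_dual hW hA hB (e 0).2 (e 1).2 (e 2).2 (f 0).2 (f 1).2 (f 2).2
    ?_ ?_ ?_ ?_ ?_ ?_ ?_ ?_ ?_ <;> rw [hef] <;> rfl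

end IsIsotropicSpread

/-- Two distinct members of a spread on a common point `x` span a 5-dimensional subspace. -/
lemma IsSpread23.finrank_sup {F : Set (Submodule (ZMod 2) V72)} (hF : IsSpread23 F)
    {S S' : Submodule (ZMod 2) V72} (hS : S ∈ F) (hS' : S' ∈ F) (hne : S ≠ S') {x : V72}
    (hx : x ≠ 0) (hxS : x ∈ S) (hxS' : x ∈ S') :
    finrank (ZMod 2) (S ⊔ S' : Submodule (ZMod 2) V72) = 5 := by
  have hinf : S ⊓ S' = span (ZMod 2) {x} := by
    refine le_antisymm (fun y ⟨hy, hy'⟩ => ?_) (by simp [hxS, hxS'])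
    by_contra hyx
    refine hne ((hF.existsUnique_mem_mem hx (y := y) ?_ ?_).unique ⟨hS, hxS, hy⟩ ⟨hS', hxS', hy'⟩)
    · rintro rfl
      exact hyx (Submodule.zero_mem _)
    · rintro rfl
      exact hyx (mem_span_singleton_self _)
  have h := Submodule.finrank_sup_add_finrank_inf_eq S S'
  rw [hinf, finrank_span_singleton hx, hF.1 S hS, hF.1 S' hS'] at h
  omega

open scoped Classical in
/-- If all members of `F` in a 5-dimensional subspace `T` pass through `x`, they cover `T`. -/
lemma IsSpread23.exists_mem_of_forall_mem {F : Set (Submodule (ZMod 2) V72)} (hF : IsSpread23 F)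
    {T : Submodule (ZMod 2) V72} (hT : finrank (ZMod 2) T = 5) {x : V72} (hx : x ≠ 0)
    (hxT : ∀ S ∈ F, S ≤ T → x ∈ S) {y : V72} (hy : y ∈ T) : ∃ S ∈ F, S ≤ T ∧ y ∈ S := by
  have hcard := hF.card_filter_le_s14 hT
  have hmem : ∀ S ∈ (members F).filter (· ≤ T), S ∈ F ∧ S ≤ T ∧ x ∈ S := fun S hS => by
    rw [Finset.mem_filter, mem_members] at hS
    exact ⟨hS.1, hS.2, hxT S hS.1 hS.2⟩
  have hvec : ∀ S : Submodule (ZMod 2) V72, x ∈ S →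
      (((vectors S).erase 0).erase x).card = 2 ^ finrank (ZMod 2) S - 1 - 1 := fun S hS => by
    rw [Finset.card_erase_of_mem (by simp [hx, hS]), card_vectors_erase]
  have hunion : (((members F).filter (· ≤ T)).biUnion
      fun S => ((vectors S).erase 0).erase x).card = 30 := by
    rw [Finset.card_biUnion, Finset.sum_congr rfl (g := fun _ => 6), Finset.sum_const, hcard]
    · rfl
    · intro S hS
      rw [hvec S (hmem S hS).2.2, hF.1 S (hmem S hS).1]
      rfl
    · intro S hS S' hS' hne
      refine Finset.disjoint_left.2 fun z hz hz' => hne ?_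
      simp only [Finset.mem_erase, mem_vectors] at hz hz'
      exact (hF.existsUnique_mem_mem hx hz.2.1 (Ne.symm hz.1)).unique
        ⟨(hmem S hS).1, (hmem S hS).2.2, hz.2.2⟩ ⟨(hmem S' hS').1, (hmem S' hS').2.2, hz'.2.2⟩
  obtain ⟨S₀, hS₀⟩ : ((members F).filter (· ≤ T)).Nonempty :=
    Finset.card_pos.1 (by rw [hcard]; norm_num)
  obtain ⟨hS₀F, hS₀T, hxS₀⟩ := hmem S₀ hS₀
  have heq : (((members F).filter (· ≤ T)).biUnion
      fun S => ((vectors S).erase 0).erase x) = ((vectors T).erase 0).erase x := by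
    refine Finset.eq_of_subset_of_card_le ?_ ?_
    · intro z hz
      simp only [Finset.mem_biUnion, Finset.mem_erase, mem_vectors] at hz ⊢
      obtain ⟨S, hS, h1, h2, h3⟩ := hz
      exact ⟨h1, h2, (hmem S hS).2.1 h3⟩
    · rw [hunion, hvec T (hS₀T hxS₀), hT]
      rfl
  by_cases hy' : y ≠ x ∧ y ≠ 0
  · have : y ∈ ((vectors T).erase 0).erase x := by simp [hy', hy]
    rw [← heq] at this
    simp only [Finset.mem_biUnion, Finset.mem_erase, mem_vectors] at this
    obtain ⟨S, hS, -, -, hyS⟩ := this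
    exact ⟨S, (hmem S hS).1, (hmem S hS).2.1, hyS⟩
  · refine ⟨S₀, hS₀F, hS₀T, ?_⟩
    rw [not_and_or, not_not, not_not] at hy'
    obtain rfl | rfl := hy'
    · exact hxS₀
    · exact S₀.zero_mem

open scoped Classical in
/-- If every point of the hyperplane `U` is an alpha-point, then the members of `F` in `U` through
a point of `U` cover a 5-dimensional subspace. -/
lemma IsSpread23.exists_perp {F : Set (Submodule (ZMod 2) V72)} (hF : IsSpread23 F)
    {U : Submodule (ZMod 2) V72} (hU : finrank (ZMod 2) U = 6)
    (halpha : ∀ P : Submodule (ZMod 2) V72, finrank (ZMod 2) P = 1 → P ≤ U → IsAlphaPoint F P)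
    {x : V72} (hx : x ≠ 0) (hxU : x ∈ U) : ∃ T ≤ U, finrank (ZMod 2) T = 5 ∧
      ∀ y, y ∈ T ↔ ∃ S ∈ F, S ≤ U ∧ x ∈ S ∧ y ∈ S := by
  have hcard := hF.card_filter_le_and_mem hU hx hxU
  obtain ⟨S₁, hS₁, S₂, hS₂, hne⟩ := Finset.one_lt_card.1 (hcard ▸ (by norm_num : 1 < 5))
  simp only [Finset.mem_filter, mem_members] at hS₁ hS₂
  have hTU : S₁ ⊔ S₂ ≤ U := sup_le hS₁.2.1 hS₂.2.1
  have hT := hF.finrank_sup hS₁.1 hS₂.1 hne hx hS₁.2.2 hS₂.2.2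
  have hxT : ∀ S ∈ F, S ≤ S₁ ⊔ S₂ → x ∈ S := fun S hS hST => by
    have := (halpha (span (ZMod 2) {x}) (finrank_span_singleton hx) (by simpa using hxU)).2 _ hT
      ⟨S₁, S₂, hS₁.1, hS₂.1, hne, le_sup_left, le_sup_right, by simpa using hS₁.2.2,
        by simpa using hS₂.2.2⟩ S hS hST
    simpa using this
  have heq : (members F).filter (· ≤ S₁ ⊔ S₂) = (members F).filter fun S => S ≤ U ∧ x ∈ S := by
    refine Finset.eq_of_subset_of_card_le ?_ (by rw [hcard, hF.card_filter_le_s14 hT])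
    intro S hS
    simp only [Finset.mem_filter, mem_members] at hS ⊢
    exact ⟨hS.1, hS.2.trans hTU, hxT S hS.1 hS.2⟩
  refine ⟨S₁ ⊔ S₂, hTU, hT, fun y => ⟨fun hy => ?_, ?_⟩⟩
  · obtain ⟨S, hS, hST, hyS⟩ := hF.exists_mem_of_forall_mem hT hx hxT hy
    exact ⟨S, hS, hST.trans hTU, hxT S hS hST, hyS⟩
  · rintro ⟨S, hS, hSU, hxS, hyS⟩
    have : S ∈ (members F).filter (· ≤ S₁ ⊔ S₂) := by
      rw [heq, Finset.mem_filter, mem_members]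
      exact ⟨hS, hSU, hxS⟩
    exact (Finset.mem_filter.1 this).2 hyS

/-- If every point of the hyperplane `U` is an alpha-point, then collinearity by members of `F`
in `U` is orthogonality for a symplectic form on `U`. -/
lemma IsSpread23.exists_isIsotropicSpread {F : Set (Submodule (ZMod 2) V72)} (hF : IsSpread23 F)
    {U : Submodule (ZMod 2) V72} (hU : finrank (ZMod 2) U = 6)
    (halpha : ∀ P : Submodule (ZMod 2) V72, finrank (ZMod 2) P = 1 → P ≤ U → IsAlphaPoint F P) :
    ∃ ω : U → U →ₗ[ZMod 2] ZMod 2, IsIsotropicSpread ω {S | S.map U.subtype ∈ F} := by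
  have hcover : ∀ y ∈ U, ∃ S ∈ F, S ≤ U ∧ y ∈ S := by
    have hnz : ∀ y ∈ U, y ≠ 0 → ∃ S ∈ F, S ≤ U ∧ y ∈ S := by
      intro y hy hy0
      obtain ⟨T, -, -, hT⟩ := hF.exists_perp hU halpha hy0 hy
      obtain ⟨S, hS, hSU, hyS, -⟩ := (hT 0).1 T.zero_mem
      exact ⟨S, hS, hSU, hyS⟩
    intro y hy
    by_cases hy0 : y = 0
    · obtain ⟨z, hz, hz0⟩ : ∃ z ∈ U, z ≠ 0 := by
        refine Submodule.exists_mem_ne_zero_of_ne_bot fun hbot => ?_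
        rw [hbot, finrank_bot] at hU
        omega
      obtain ⟨S, hS, hSU, -⟩ := hnz z hz hz0
      exact ⟨S, hS, hSU, hy0 ▸ S.zero_mem⟩
    · exact hnz y hy hy0
  have hform : ∀ x : U, ∃ f : U →ₗ[ZMod 2] ZMod 2, (x ≠ 0 → f ≠ 0) ∧
      ∀ y : U, f y = 0 ↔ ∃ S ∈ F, S ≤ U ∧ (x : V72) ∈ S ∧ (y : V72) ∈ S := by
    intro x
    by_cases hx : x = 0
    · refine ⟨0, fun h => absurd hx h, fun y => ⟨fun _ => ?_, fun _ => rfl⟩⟩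
      obtain ⟨S, hS, hSU, hyS⟩ := hcover y y.2
      exact ⟨S, hS, hSU, by simp [hx], hyS⟩
    · obtain ⟨T, hTU, hT, hmem⟩ := hF.exists_perp hU halpha (by simpa using hx) x.2
      have hT' : finrank (ZMod 2) (T.comap U.subtype) = 5 := by
        rw [← hT]
        exact (Submodule.comapSubtypeEquivOfLe hTU).finrank_eq
      obtain ⟨f, hf, hle⟩ := (T.comap U.subtype).exists_le_ker_of_lt_top
        (lt_top_iff_ne_top.2 fun htop => by rw [htop, finrank_top] at hT'; omega)
      have hker : T.comap U.subtype = LinearMap.ker f := by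
        have := Module.Dual.finrank_ker_add_one_of_ne_zero (f := f) hf
        exact Submodule.eq_of_le_of_finrank_eq hle (by omega)
      refine ⟨f, fun _ => hf, fun y => ?_⟩
      rw [← hmem, ← LinearMap.mem_ker, ← hker]
      rfl
  choose ω hne hω using hform
  refine ⟨ω, fun x y => ?_, fun x hx => not_imp_not.1 (hne x) hx, fun S hS => ?_,
    fun S hS x hx y hy => ?_, fun x y hxy => ?_, ?_⟩
  · have hiff : ω x y = 0 ↔ ω y x = 0 := by
      rw [hω, hω]
      simp only [and_comm]
    generalize ω x y = a at *
    generalize ω y x = b at *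
    revert a b
    decide
  · rw [← hF.1 _ hS]
    exact (Submodule.equivMapOfInjective _ U.subtype_injective S).finrank_eq
  · exact (hω x y).2 ⟨_, hS, Submodule.map_subtype_le U S, Submodule.mem_map_of_mem hx,
      Submodule.mem_map_of_mem hy⟩
  · obtain ⟨S, hS, hSU, hxS, hyS⟩ := (hω x y).1 hxy
    refine ⟨S.comap U.subtype, ?_, hxS, hyS⟩
    rwa [Set.mem_ofPred_eq, Submodule.map_comap_subtype, inf_eq_right.2 hSU]
  · intro S hS S' hS' x y hx hy hxy hxS hyS hxS' hyS'
    refine Submodule.map_injective_of_injective U.subtype_injective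
      ((hF.existsUnique_mem_mem (x := x) (y := y) ?_ ?_ ?_).unique
        ⟨hS, Submodule.mem_map_of_mem hxS, Submodule.mem_map_of_mem hyS⟩
        ⟨hS', Submodule.mem_map_of_mem hxS', Submodule.mem_map_of_mem hyS'⟩)
    · simpa using hx
    · simpa using hy
    · simpa using hxy

end

/-- Every 6-dimensional subspace contains a point which is not an alpha-point:
there is a 5-dimensional subspace containing two members of `F` through `P`, but
some member of `F` inside it avoids `P`. -/
theorem exists_non_alpha_point (F : Set (Submodule (ZMod 2) V72)) (hF : IsSpread23 F)
    (U : Submodule (ZMod 2) V72) (hU : Module.finrank (ZMod 2) U = 6) :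
    ∃ P : Submodule (ZMod 2) V72, Module.finrank (ZMod 2) P = 1 ∧ P ≤ U ∧
      ∃ T : Submodule (ZMod 2) V72, Module.finrank (ZMod 2) T = 5 ∧
        (∃ S1 S2, S1 ∈ F ∧ S2 ∈ F ∧ S1 ≠ S2 ∧ S1 ≤ T ∧ S2 ≤ T ∧ P ≤ S1 ∧ P ≤ S2) ∧
        ∃ S ∈ F, S ≤ T ∧ ¬ P ≤ S := by
  by_contra! hcon
  have halpha : ∀ P : Submodule (ZMod 2) V72, Module.finrank (ZMod 2) P = 1 → P ≤ U →
      IsAlphaPoint F P := fun P hP hPU => by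
    refine ⟨hP, fun T hT ⟨S₁, S₂, h₁, h₂, hne, hle₁, hle₂, hP₁, hP₂⟩ S hS hSle => ?_⟩
    exact hcon P hP hPU T hT ⟨S₁, S₂, h₁, h₂, hne, hle₁, hle₂, hP₁, hP₂⟩ S hS hSle
  obtain ⟨ω, hω⟩ := hF.exists_isIsotropicSpread hU halpha
  exact hω.finrank_ne_six hU
end
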